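/- arXiv:2512.19409 — 4 statements merged into one kernel-verified Lean document; each statement's English description precedes it below -/
import Mathlib

section
/- Let V be a 2n-dimensional real vector space (n ≥ 1) and let ω and Ω be two symplectic forms on V. If the set of Lagrangian subspaces of V with respect to ω coincides with the set of Lagrangian subspaces with respect to Ω, then there exists a nonzero constant c ∈ ℝ such that Ω(u,v) = c·ω(u,v) for all u,v ∈ V. -/
open Module Submodule

namespace LinearMap.BilinForm

variable {K V : Type*} [Field K] [AddCommGroup V] [Module K V] {B : LinearMap.BilinForm K V}

theorem sup_span_singleton_le_orthogonal (hB : B.IsAlt) {L : Submodule K V}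
    (hL : L ≤ B.orthogonal L) {v : V} (hv : v ∈ B.orthogonal L) :
    L ⊔ span K {v} ≤ B.orthogonal (L ⊔ span K {v}) := by
  intro x hx y hy
  obtain ⟨a, ha, _, hs, rfl⟩ := mem_sup.1 hx
  obtain ⟨s, rfl⟩ := mem_span_singleton.1 hs
  obtain ⟨b, hb, _, ht, rfl⟩ := mem_sup.1 hy
  obtain ⟨t, rfl⟩ := mem_span_singleton.1 ht
  have hba : B b a = 0 := hL ha b hb
  have hbv : B b v = 0 := hv b hb
  have hva : B v a = 0 := hB.eq_iff.1 (hv a ha)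
  have hvv : B v v = 0 := hB v
  simp [hba, hbv, hva, hvv]

theorem exists_le_eq_orthogonal [FiniteDimensional K V] (hB : B.IsAlt) (L : Submodule K V)
    (hL : L ≤ B.orthogonal L) : ∃ M, L ≤ M ∧ M = B.orthogonal M := by
  induction L using WellFoundedGT.induction with
  | ind L ih =>
    by_cases h : B.orthogonal L ≤ L
    · exact ⟨L, le_rfl, le_antisymm hL h⟩
    · obtain ⟨v, hv, hvL⟩ := SetLike.not_le_iff_exists.1 h
      have hlt : L < L ⊔ span K {v} := by
        simpa [left_lt_sup, span_singleton_le_iff_mem] using hvL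
      obtain ⟨M, hM, hMo⟩ := ih _ hlt (sup_span_singleton_le_orthogonal hB hL hv)
      exact ⟨M, hlt.le.trans hM, hMo⟩

theorem exists_mem_mem_eq_orthogonal [FiniteDimensional K V] (hB : B.IsAlt) {x y : V}
    (hxy : B x y = 0) : ∃ M : Submodule K V, x ∈ M ∧ y ∈ M ∧ M = B.orthogonal M := by
  have hx : span K {x} ≤ B.orthogonal (span K {x}) := by
    simpa using sup_span_singleton_le_orthogonal hB (L := ⊥) bot_le (v := x) (by simp)
  have hy : y ∈ B.orthogonal (span K {x}) := fun z hz => by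
    obtain ⟨t, rfl⟩ := mem_span_singleton.1 hz
    simp [hxy]
  obtain ⟨M, hM, hMo⟩ :=
    exists_le_eq_orthogonal hB _ (sup_span_singleton_le_orthogonal hB hx hy)
  exact ⟨M, hM (mem_sup_left (mem_span_singleton_self x)),
    hM (mem_sup_right (mem_span_singleton_self y)), hMo⟩

/-- A bilinear form vanishing wherever a nondegenerate form vanishes is a multiple of it. -/
theorem exists_eq_smul_of_forall_isOrtho [FiniteDimensional K V] (hB : B.Nondegenerate)
    {C : LinearMap.BilinForm K V} (h : ∀ x y, B x y = 0 → C x y = 0) : ∃ c : K, C = c • B := by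
  let e := B.toDual hB
  have key : ∀ v, ¬ LinearIndependent K ![v, (e.symm.toLinearMap ∘ₗ C) v] := by
    intro v hv
    have hspan : C v ∈ span K (Set.range fun _ : Unit => B v) :=
      mem_span_of_iInf_ker_le_ker (by simpa using! fun y hy => h v y hy)
    rw [Set.range_const, mem_span_singleton] at hspan
    obtain ⟨c, hc⟩ := hspan
    have hcv : e.symm (C v) = c • v := by
      rw [LinearEquiv.symm_apply_eq, map_smul, ← hc]
      rfl
    have hv0 : v ≠ 0 := hv.ne_zero 0
    exact (LinearIndependent.pair_iff' hv0).1 hv c hcv.symm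
  obtain ⟨c, hc⟩ := LinearMap.exists_eq_smul_id_of_forall_notLinearIndependent key
  refine ⟨c, LinearMap.ext fun v => ?_⟩
  have hv : e.symm (C v) = c • v := LinearMap.congr_fun hc v
  rw [LinearEquiv.symm_apply_eq, map_smul] at hv
  exact hv

end LinearMap.BilinForm


/-- Let `V` be a `2n`-dimensional real vector space (`n ≥ 1`) and let
`ω`, `Ω` be two symplectic forms (bilinear, alternating, nondegenerate) on `V`. If the
Lagrangian subspaces of `ω` are exactly the Lagrangian subspaces of `Ω`, then `Ω = c • ω`
for some nonzero constant `c`. -/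
theorem proportional_of_same_lagrangians
    {V : Type*} [AddCommGroup V] [Module ℝ V] [FiniteDimensional ℝ V]
    (n : ℕ) (hn : 1 ≤ n) (hdim : Module.finrank ℝ V = 2 * n)
    (ω Ω : V →ₗ[ℝ] V →ₗ[ℝ] ℝ)
    (hωalt : ∀ v : V, ω v v = 0)
    (hωnd : ∀ u : V, (∀ v : V, ω u v = 0) → u = 0)
    (hΩalt : ∀ v : V, Ω v v = 0)
    (hΩnd : ∀ u : V, (∀ v : V, Ω u v = 0) → u = 0)
    (hLag : ∀ L : Submodule ℝ V,
      ((∀ x ∈ L, ∀ y ∈ L, ω x y = 0) ∧ Module.finrank ℝ L = n) ↔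
      ((∀ x ∈ L, ∀ y ∈ L, Ω x y = 0) ∧ Module.finrank ℝ L = n)) :
    ∃ c : ℝ, c ≠ 0 ∧ ∀ u v : V, Ω u v = c * ω u v := by
  have hωrefl : LinearMap.IsRefl ω := LinearMap.IsAlt.isRefl hωalt
  have hnd : LinearMap.BilinForm.Nondegenerate ω :=
    hωrefl.nondegenerate_iff_separatingLeft.2 hωnd
  have hvanish : ∀ x y, ω x y = 0 → Ω x y = 0 := by
    intro x y hxy
    obtain ⟨M, hx, hy, hM⟩ := LinearMap.BilinForm.exists_mem_mem_eq_orthogonal hωalt hxy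
    have hfin := LinearMap.BilinForm.finrank_orthogonal hnd M
    rw [← hM, hdim] at hfin
    have hle := M.finrank_le
    exact ((hLag M).1 ⟨fun a ha b hb => hM.le hb a ha, by lia⟩).1 x hx y hy
  obtain ⟨c, hc⟩ := LinearMap.BilinForm.exists_eq_smul_of_forall_isOrtho hnd hvanish
  have happ : ∀ u v, Ω u v = c * ω u v := fun u v => by simp [hc]
  refine ⟨c, ?_, happ⟩
  rintro rfl
  have : Nontrivial V := Module.nontrivial_of_finrank_pos (R := ℝ) (by lia)
  obtain ⟨u, hu⟩ := exists_ne (0 : V)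
  exact hu (hΩnd u fun v => by simp [happ])
end

section
/- Let V be a finite-dimensional real vector space and let ω and Ω be two symplectic forms on V such that for all u,v ∈ V, ω(u,v) = 0 if and only if Ω(u,v) = 0. Then there exists a nonzero constant c ∈ ℝ such that Ω(u,v) = c·ω(u,v) for all u,v ∈ V. -/
/-- If the zero pairs of `B` are zero pairs of `C`, then `B u` and `C u` are proportional. -/
theorem LinearMap.mul_eq_mul_of_apply_eq_zero_imp {R M N : Type*} [CommRing R]
    [AddCommGroup M] [Module R M] [AddCommGroup N] [Module R N] (B C : M →ₗ[R] N →ₗ[R] R)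
    (h : ∀ u v, B u v = 0 → C u v = 0) (u : M) (v w : N) :
    C u v * B u w = C u w * B u v := by
  have h₀ : B u (B u w • v - B u v • w) = 0 := by simp [mul_comm]
  have h₁ := h _ _ h₀
  simp only [map_sub, map_smul, smul_eq_mul] at h₁
  linear_combination h₁

/-- If two symplectic forms `ω`, `Ω` (bilinear, alternating,
nondegenerate) on a finite-dimensional real vector space have the same vanishing pairs,
then they are proportional by a nonzero constant. -/
theorem proportional_of_same_orthogonality
    {V : Type*} [AddCommGroup V] [Module ℝ V] [FiniteDimensional ℝ V]
    (ω Ω : V →ₗ[ℝ] V →ₗ[ℝ] ℝ)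
    (hωalt : ∀ v : V, ω v v = 0)
    (hωnd : ∀ u : V, (∀ v : V, ω u v = 0) → u = 0)
    (hΩalt : ∀ v : V, Ω v v = 0)
    (hΩnd : ∀ u : V, (∀ v : V, Ω u v = 0) → u = 0)
    (h : ∀ u v : V, ω u v = 0 ↔ Ω u v = 0) :
    ∃ c : ℝ, c ≠ 0 ∧ ∀ u v : V, Ω u v = c * ω u v := by
  have right := LinearMap.mul_eq_mul_of_apply_eq_zero_imp ω Ω fun u v => (h u v).1
  have left (u w v : V) : Ω u v * ω w v = Ω w v * ω u v :=
    LinearMap.mul_eq_mul_of_apply_eq_zero_imp ω.flip Ω.flip (fun u v => (h v u).1) v u w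
  by_cases h₀ : ∀ a b, ω a b = 0
  · exact ⟨1, one_ne_zero, fun u v => by rw [h₀, (h u v).1 (h₀ u v), mul_zero]⟩
  push Not at h₀
  obtain ⟨a, b, hab⟩ := h₀
  refine ⟨Ω a b / ω a b, div_ne_zero (mt (h a b).2 hab) hab, fun u v => ?_⟩
  rw [div_mul_eq_mul_div, eq_div_iff hab]
  by_cases hav : ω a v = 0
  · by_cases hub : ω u b = 0
    · simpa [hav, hub, (h a v).1 hav, (h u b).1 hub] using right (a + u) v b
    · apply mul_right_cancel₀ hub
      linear_combination ω a b * right u v b + ω u v * left u a b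
  · apply mul_right_cancel₀ hav
    linear_combination ω a b * left u a v + ω u v * right a v b
end

section
/- Let V be a finite-dimensional real symplectic vector space with symplectic form ω, and let F : V → V be a linear isomorphism. Then F maps every Lagrangian subspace of V onto a Lagrangian subspace of V if and only if there exists a nonzero constant c ∈ ℝ such that ω(F u, F v) = c·ω(u,v) for all u,v ∈ V (i.e., F is a linear conformal symplectomorphism). -/
open LinearMap (BilinForm)
open Module Submodule

section

variable {K V : Type*} [Field K] [AddCommGroup V] [Module K V] {B : BilinForm K V}

/-- Adjoining to an isotropic subspace a vector orthogonal to it gives an isotropic subspace. -/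
lemma LinearMap.BilinForm.IsAlt.sup_span_singleton_le_orthogonal (hB : B.IsAlt)
    {W : Submodule K V} (hW : W ≤ B.orthogonal W) {x : V} (hx : x ∈ B.orthogonal W) :
    W ⊔ K ∙ x ≤ B.orthogonal (W ⊔ K ∙ x) := by
  intro a ha b hb
  obtain ⟨w, hw, _, hs, rfl⟩ := mem_sup.1 ha
  obtain ⟨s, rfl⟩ := mem_span_singleton.1 hs
  obtain ⟨w', hw', _, ht, rfl⟩ := mem_sup.1 hb
  obtain ⟨t, rfl⟩ := mem_span_singleton.1 ht
  have h₁ : B w' w = 0 := hW hw w' hw'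
  have h₂ : B w' x = 0 := hx w' hw'
  have h₃ : B x w = 0 := hB.isRefl _ _ (hx w hw)
  simp [h₁, h₂, h₃, hB.self_eq_zero x]

/-- Every isotropic subspace is contained in one that is its own orthogonal complement. -/
lemma LinearMap.BilinForm.IsAlt.exists_le_orthogonal_eq_self [FiniteDimensional K V]
    (hB : B.IsAlt) {W : Submodule K V} (hW : W ≤ B.orthogonal W) :
    ∃ L, W ≤ L ∧ B.orthogonal L = L := by
  obtain ⟨L, hWL, hL⟩ := exists_maximal_ge_of_wellFoundedGT
    (fun L : Submodule K V ↦ L ≤ B.orthogonal L) W hW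
  refine ⟨L, hWL, le_antisymm (fun x hx ↦ ?_) hL.prop⟩
  exact hL.le_of_ge (hB.sup_span_singleton_le_orthogonal hL.prop hx) le_sup_left
    (mem_sup_right (mem_span_singleton_self x))

/-- In a symplectic vector space of dimension `2 * n`, orthogonal vectors lie in a common
Lagrangian subspace. -/
lemma LinearMap.BilinForm.IsAlt.exists_lagrangian_of_apply_eq_zero [FiniteDimensional K V]
    (hB : B.IsAlt) (hnd : B.Nondegenerate) {n : ℕ} (hdim : finrank K V = 2 * n) {u v : V}
    (h : B u v = 0) :
    ∃ L : Submodule K V, (∀ x ∈ L, ∀ y ∈ L, B x y = 0) ∧ finrank K L = n ∧ u ∈ L ∧ v ∈ L := by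
  have hbot : (⊥ : Submodule K V) ≤ B.orthogonal ⊥ := bot_le
  have hu := hB.sup_span_singleton_le_orthogonal hbot (x := u) (by simp)
  have hv : v ∈ B.orthogonal (⊥ ⊔ K ∙ u) := by
    intro a ha
    rw [bot_sup_eq] at ha
    obtain ⟨s, rfl⟩ := mem_span_singleton.1 ha
    simp [h]
  obtain ⟨L, hle, hL⟩ :=
    hB.exists_le_orthogonal_eq_self (hB.sup_span_singleton_le_orthogonal hu hv)
  refine ⟨L, fun x hx y hy ↦ ?_, ?_, ?_, ?_⟩
  · rw [← hL] at hy
    exact hy x hx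
  · have := BilinForm.finrank_orthogonal hnd L
    have := L.finrank_le
    rw [hL] at *
    lia
  · exact hle (mem_sup_left (mem_sup_right (mem_span_singleton_self u)))
  · exact hle (mem_sup_right (mem_span_singleton_self v))

/-- A bilinear form that vanishes wherever a nondegenerate form `B` does is a multiple of `B`. -/
lemma LinearMap.Nondegenerate.exists_eq_smul [FiniteDimensional K V]
    (hnd : B.Nondegenerate) {B' : BilinForm K V} (h : ∀ u v, B u v = 0 → B' u v = 0) :
    ∃ c : K, B' = c • B := by
  let T : V →ₗ[K] V := (B.toDual hnd).symm.toLinearMap ∘ₗ B'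
  have hT (u v : V) : B (T u) v = B' u v := BilinForm.apply_toDual_symm_apply (hB := hnd) (B' u) v
  obtain ⟨c, hc⟩ := T.exists_eq_smul_id_of_forall_notLinearIndependent fun u ↦ by
    have hmem : B' u ∈ span K (Set.range fun _ : Unit ↦ B u) :=
      mem_span_of_iInf_ker_le_ker fun v hv ↦ h u v (by simpa using hv)
    rw [Set.range_const] at hmem
    obtain ⟨a, ha⟩ := mem_span_singleton.1 hmem
    have hTu : T u = a • u := by
      refine (B.toDual hnd).injective (LinearMap.ext fun v ↦ ?_)
      simp [BilinForm.toDual_def, hT, ← ha]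
    rw [hTu]
    intro hli
    have := LinearIndependent.pair_iff.1 hli a (-1) (by simp)
    simp at this
  refine ⟨c, LinearMap.ext₂ fun u v ↦ ?_⟩
  rw [← hT, hc]
  simp

end

/-- Let `(V, ω)` be a finite-dimensional real symplectic vector space
(`dim V = 2n`) and `F : V ≃ₗ[ℝ] V` a linear isomorphism. Then `F` maps every Lagrangian
subspace onto a Lagrangian subspace iff there is a nonzero constant `c` with
`ω (F u) (F v) = c * ω u v` for all `u, v` (i.e. `F` is a linear conformal
symplectomorphism). -/
theorem maps_lagrangians_iff_conformal
    {V : Type*} [AddCommGroup V] [Module ℝ V] [FiniteDimensional ℝ V]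
    (ω : V →ₗ[ℝ] V →ₗ[ℝ] ℝ)
    (halt : ∀ v : V, ω v v = 0)
    (hnd : ∀ u : V, (∀ v : V, ω u v = 0) → u = 0)
    (n : ℕ) (hdim : Module.finrank ℝ V = 2 * n)
    (F : V ≃ₗ[ℝ] V) :
    (∀ L : Submodule ℝ V,
        ((∀ x ∈ L, ∀ y ∈ L, ω x y = 0) ∧ Module.finrank ℝ L = n) →
        ((∀ x ∈ L.map (F : V →ₗ[ℝ] V), ∀ y ∈ L.map (F : V →ₗ[ℝ] V), ω x y = 0) ∧
          Module.finrank ℝ (L.map (F : V →ₗ[ℝ] V)) = n)) ↔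
      ∃ c : ℝ, c ≠ 0 ∧ ∀ u v : V, ω (F u) (F v) = c * ω u v := by
  have hAlt : BilinForm.IsAlt ω := halt
  have hN : BilinForm.Nondegenerate ω := (hAlt.isRefl.nondegenerate_iff_separatingLeft).2 hnd
  have hF (L : Submodule ℝ V) : finrank ℝ (L.map (F : V →ₗ[ℝ] V)) = finrank ℝ L :=
    F.finrank_map_eq L
  constructor
  · intro h
    obtain ⟨c, hc⟩ := hN.exists_eq_smul (B' := ω.compl₁₂ (F : V →ₗ[ℝ] V) (F : V →ₗ[ℝ] V))
      fun u v huv ↦ by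
        obtain ⟨L, hL, hLn, hu, hv⟩ := hAlt.exists_lagrangian_of_apply_eq_zero hN hdim huv
        exact (h L ⟨hL, hLn⟩).1 _ (mem_map_of_mem hu) _ (mem_map_of_mem hv)
    have hc' (u v : V) : ω (F u) (F v) = c * ω u v := LinearMap.congr_fun₂ hc u v
    obtain rfl | hc0 := eq_or_ne c 0
    · have h0 (u v : V) : ω u v = 0 := by simpa using hc' (F.symm u) (F.symm v)
      exact ⟨1, one_ne_zero, by simp [h0]⟩
    · exact ⟨c, hc0, hc'⟩
  · rintro ⟨c, -, hc⟩ L ⟨hL, hLn⟩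
    refine ⟨?_, (hF L).trans hLn⟩
    rintro _ ⟨x, hx, rfl⟩ _ ⟨y, hy, rfl⟩
    simp [hc, hL x hx y hy]
end

section
/- Let d ∈ ℕ, let K and A be real d×d matrices with A symmetric, let μ, η ∈ ℝᵈ, let Λ be a symmetric real d×d matrix, c ∈ ℝ, and define the Gaussian-form density p(u) := exp(⟪η,u⟫ − ½⟪u, Λ·u⟫ − c). Define the Ornstein–Uhlenbeck Fokker–Planck (adjoint generator) action (L*p)(u) := −div(u ↦ p(u)·K·(μ−u))(u) + ½ Σ_{i,j} A_{ij} ∂_i ∂_j p(u). Then for every u ∈ ℝᵈ: (L*p)(u)/p(u) = ⟪a_η, u⟫ + ⟪a_Λ, −½ u·uᵀ⟫_F + b, where a_η = Kᵀη + Λ·K·μ − Λ·A·η, a_Λ = Kᵀ·Λ + Λ·K − Λ·A·Λ, b = tr(K) − ηᵀ·K·μ − ½ tr(A·Λ) + ½ ηᵀ·A·η, and ⟨M,N⟩_F = tr(Mᵀ·N) is the Frobenius inner product. In other words, (L*p)/p is an affine function a(θ)·T(u) + b(θ) of the Gaussian sufficient statistics T(u) = (u, −½ u·uᵀ), so the Ornstein–Uhlenbeck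 semigroup preserves the Gaussian exponential family (Legendre dynamics). -/
open Matrix
open scoped BigOperators

theorem differentiable_mulVec_apply {m n : Type*} [Fintype m] [Fintype n]
    (M : Matrix m n ℝ) (i : m) : Differentiable ℝ fun x : n → ℝ => (M *ᵥ x) i := by
  unfold mulVec dotProduct
  fun_prop

theorem fderiv_mulVec_apply {m n : Type*} [Fintype m] [Fintype n]
    (M : Matrix m n ℝ) (i : m) (x v : n → ℝ) :
    fderiv ℝ (fun x : n → ℝ => (M *ᵥ x) i) x v = (M *ᵥ v) i := by
  rw [← (differentiable_mulVec_apply M i x).lineDeriv_eq_fderiv]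
  refine HasDerivAt.deriv ?_
  simp only [mulVec_add, mulVec_smul, Pi.add_apply, Pi.smul_apply, smul_eq_mul]
  simpa using ((hasDerivAt_id (0 : ℝ)).mul_const ((M *ᵥ v) i)).const_add ((M *ᵥ x) i)

section GaussianForm

variable {n : Type*} [Fintype n] (η : n → ℝ) (Λ : Matrix n n ℝ) (c : ℝ)

/-- The density `exp(⟪η,u⟫ − ½⟪u,Λu⟫ − c)` in natural parameters. -/
noncomputable def gaussianForm (u : n → ℝ) : ℝ :=
  Real.exp (η ⬝ᵥ u - (1/2) * (u ⬝ᵥ Λ *ᵥ u) - c)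

theorem contDiff_gaussianForm {k : WithTop ℕ∞} : ContDiff ℝ k (gaussianForm η Λ c) := by
  unfold gaussianForm mulVec dotProduct
  fun_prop

theorem differentiable_gaussianForm : Differentiable ℝ (gaussianForm η Λ c) :=
  (contDiff_gaussianForm η Λ c (k := 1)).differentiable one_ne_zero

variable {Λ}

theorem fderiv_gaussianForm (hΛ : Λᵀ = Λ) (u v : n → ℝ) :
    fderiv ℝ (gaussianForm η Λ c) u v = gaussianForm η Λ c u * ((η - Λ *ᵥ u) ⬝ᵥ v) := by
  rw [← (differentiable_gaussianForm η Λ c u).lineDeriv_eq_fderiv]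
  refine HasDerivAt.deriv ?_
  have hsymm : u ⬝ᵥ Λ *ᵥ v = v ⬝ᵥ Λ *ᵥ u := by
    rw [dotProduct_mulVec, ← mulVec_transpose, hΛ, dotProduct_comm]
  have hline (t : ℝ) : η ⬝ᵥ (u + t • v) - (1/2) * ((u + t • v) ⬝ᵥ Λ *ᵥ (u + t • v)) - c
      = (η ⬝ᵥ u - (1/2) * (u ⬝ᵥ Λ *ᵥ u) - c) + t * ((η - Λ *ᵥ u) ⬝ᵥ v)
        - t ^ 2 * ((1/2) * (v ⬝ᵥ Λ *ᵥ v)) := by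
    simp only [mulVec_add, mulVec_smul, dotProduct_add, add_dotProduct, smul_dotProduct,
      dotProduct_smul, sub_dotProduct, smul_eq_mul, hsymm, dotProduct_comm (Λ *ᵥ u) v]
    ring
  simp only [gaussianForm, hline]
  have h := ((((hasDerivAt_id (0 : ℝ)).mul_const ((η - Λ *ᵥ u) ⬝ᵥ v)).const_add
    (η ⬝ᵥ u - (1/2) * (u ⬝ᵥ Λ *ᵥ u) - c)).sub
    (((hasDerivAt_id (0 : ℝ)).pow 2).mul_const ((1/2) * (v ⬝ᵥ Λ *ᵥ v)))).exp
  simpa using h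

theorem fderiv_fderiv_gaussianForm (hΛ : Λᵀ = Λ) (u v w : n → ℝ) :
    fderiv ℝ (fderiv ℝ (gaussianForm η Λ c)) u v w
      = gaussianForm η Λ c u
        * (((η - Λ *ᵥ u) ⬝ᵥ v) * ((η - Λ *ᵥ u) ⬝ᵥ w) - (Λ *ᵥ v) ⬝ᵥ w) := by
  have hd : DifferentiableAt ℝ (fderiv ℝ (gaussianForm η Λ c)) u :=
    ((contDiff_gaussianForm η Λ c (k := 2)).fderiv_right (m := 1) (by norm_num)).differentiable
      one_ne_zero u
  have happly : fderiv ℝ (fderiv ℝ (gaussianForm η Λ c)) u v w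
      = fderiv ℝ (fun x => fderiv ℝ (gaussianForm η Λ c) x w) u v := by
    rw [fderiv_clm_apply hd (differentiableAt_const w)]
    simp
  have hlin (x : n → ℝ) : (η - Λ *ᵥ x) ⬝ᵥ w = η ⬝ᵥ w - (Λ *ᵥ w) ⬝ᵥ x := by
    rw [sub_dotProduct, dotProduct_comm (Λ *ᵥ x), dotProduct_mulVec, ← mulVec_transpose, hΛ]
  have hscore : HasFDerivAt (fun x => (η - Λ *ᵥ x) ⬝ᵥ w)
      (-LinearMap.toContinuousLinearMap (dotProductBilin ℝ ℝ (Λ *ᵥ w))) u := by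
    simp only [hlin]
    exact (LinearMap.toContinuousLinearMap (dotProductBilin ℝ ℝ (Λ *ᵥ w))).hasFDerivAt.const_sub _
  simp only [happly, fderiv_gaussianForm η c hΛ]
  rw [((differentiable_gaussianForm η Λ c u).hasFDerivAt.fun_mul hscore).fderiv]
  have hsymm : (Λ *ᵥ w) ⬝ᵥ v = (Λ *ᵥ v) ⬝ᵥ w := by
    rw [dotProduct_comm, dotProduct_mulVec, ← mulVec_transpose, hΛ]
  simp [fderiv_gaussianForm η c hΛ, hsymm]
  ring

theorem sum_fderiv_gaussianForm_mul_drift [DecidableEq n] (hΛ : Λᵀ = Λ) (K : Matrix n n ℝ)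
    (μ u : n → ℝ) :
    ∑ i, fderiv ℝ (fun x => gaussianForm η Λ c x * (K *ᵥ (μ - x)) i) u (Pi.single i 1)
      = gaussianForm η Λ c u * ((η - Λ *ᵥ u) ⬝ᵥ K *ᵥ (μ - u) - K.trace) := by
  have hterm (i : n) :
      fderiv ℝ (fun x => gaussianForm η Λ c x * (K *ᵥ (μ - x)) i) u (Pi.single i 1)
        = gaussianForm η Λ c u * ((η - Λ *ᵥ u) i * (K *ᵥ (μ - u)) i - K i i) := by
    have hdrift := (differentiable_mulVec_apply K i u).hasFDerivAt.const_sub ((K *ᵥ μ) i)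
    have hprod := ((differentiable_gaussianForm η Λ c u).hasFDerivAt.fun_mul hdrift).fderiv
    simp only [mulVec_sub, Pi.sub_apply]
    rw [hprod]
    simp [fderiv_gaussianForm η c hΛ, fderiv_mulVec_apply]
    ring
  simp only [hterm, ← Finset.mul_sum, Finset.sum_sub_distrib]
  rfl

theorem sum_mul_fderiv_fderiv_gaussianForm [DecidableEq n] (hΛ : Λᵀ = Λ) (A : Matrix n n ℝ)
    (u : n → ℝ) :
    ∑ i, ∑ j, A i j * fderiv ℝ (fderiv ℝ (gaussianForm η Λ c)) u (Pi.single i 1) (Pi.single j 1)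
      = gaussianForm η Λ c u
        * ((η - Λ *ᵥ u) ⬝ᵥ A *ᵥ (η - Λ *ᵥ u) - (A * Λ).trace) := by
  simp only [fderiv_fderiv_gaussianForm η c hΛ, dotProduct_single_one, mulVec_single_one]
  generalize η - Λ *ᵥ u = s
  simp only [trace, diag_apply, mul_apply, dotProduct, mulVec, Finset.mul_sum,
    ← Finset.sum_sub_distrib, col_apply]
  refine Finset.sum_congr rfl fun i _ => Finset.sum_congr rfl fun j _ => ?_
  ring

end GaussianForm

/-- For the Gaussian-form density
`p(u) = exp(⟪η,u⟫ − ½⟪u,Λu⟫ − c)` (with `Λ` symmetric) and the Ornstein–Uhlenbeck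
Fokker–Planck adjoint generator
`(L*p)(u) = −div(u ↦ p(u)·K·(μ−u))(u) + ½ Σᵢⱼ Aᵢⱼ ∂ᵢ∂ⱼ p(u)` (with `A` symmetric),
one has for every `u`:
`(L*p)(u)/p(u) = ⟪a_η, u⟫ + ⟪a_Λ, −½ u·uᵀ⟫_F + b`, where
`a_η = Kᵀη + Λ·K·μ − Λ·A·η`, `a_Λ = Kᵀ·Λ + Λ·K − Λ·A·Λ`,
`b = tr K − ηᵀKμ − ½ tr(AΛ) + ½ ηᵀAη`, and `⟨M,N⟩_F = tr(Mᵀ·N)`.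
Thus `(L*p)/p` is affine in the Gaussian sufficient statistics
`T(u) = (u, −½ u·uᵀ)`: the Ornstein–Uhlenbeck semigroup preserves the Gaussian
exponential family (Legendre dynamics). -/
theorem ou_adjoint_generator_affine_in_sufficient_statistics
    (d : ℕ) (K A : Matrix (Fin d) (Fin d) ℝ) (hA : Aᵀ = A)
    (μ η : Fin d → ℝ) (Λ : Matrix (Fin d) (Fin d) ℝ) (hΛ : Λᵀ = Λ) (c : ℝ)
    (p : (Fin d → ℝ) → ℝ)
    (hp : p = fun u => Real.exp (η ⬝ᵥ u - (1/2) * (u ⬝ᵥ Λ.mulVec u) - c))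
    (Lstarp : (Fin d → ℝ) → ℝ)
    (hLstarp : Lstarp = fun u =>
      -(∑ i, fderiv ℝ (fun x => p x * (K.mulVec (μ - x)) i) u (Pi.single i (1:ℝ)))
        + (1/2) * ∑ i, ∑ j, A i j *
            fderiv ℝ (fderiv ℝ p) u (Pi.single i (1:ℝ)) (Pi.single j (1:ℝ)))
    (aη : Fin d → ℝ)
    (haη : aη = Kᵀ.mulVec η + Λ.mulVec (K.mulVec μ) - Λ.mulVec (A.mulVec η))
    (aΛ : Matrix (Fin d) (Fin d) ℝ)
    (haΛ : aΛ = Kᵀ * Λ + Λ * K - Λ * A * Λ)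
    (b : ℝ)
    (hb : b = K.trace - η ⬝ᵥ K.mulVec μ - (1/2) * (A * Λ).trace
      + (1/2) * (η ⬝ᵥ A.mulVec η)) :
    ∀ u : Fin d → ℝ,
      Lstarp u / p u
        = aη ⬝ᵥ u + (aΛᵀ * ((-(1:ℝ)/2) • vecMulVec u u)).trace + b := by
  intro u
  obtain rfl : p = gaussianForm η Λ c := hp
  have hpos : gaussianForm η Λ c u ≠ 0 := (Real.exp_pos _).ne'
  have hquad : (aΛᵀ * ((-(1:ℝ)/2) • vecMulVec u u)).trace = -(1/2) * (u ⬝ᵥ aΛ *ᵥ u) := by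
    rw [Matrix.mul_smul, trace_smul, mul_vecMulVec, trace_vecMulVec, mulVec_transpose,
      ← dotProduct_mulVec, smul_eq_mul]
    ring
  have hL : Lstarp u / gaussianForm η Λ c u
      = K.trace - (η - Λ *ᵥ u) ⬝ᵥ K *ᵥ (μ - u)
        + (1/2) * ((η - Λ *ᵥ u) ⬝ᵥ A *ᵥ (η - Λ *ᵥ u) - (A * Λ).trace) := by
    rw [hLstarp]
    simp only [sum_fderiv_gaussianForm_mul_drift η c hΛ, sum_mul_fderiv_fderiv_gaussianForm η c hΛ]
    field_simp
    ring
  have hΛs (v w : Fin d → ℝ) : (Λ *ᵥ v) ⬝ᵥ w = v ⬝ᵥ Λ *ᵥ w := by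
    rw [dotProduct_mulVec, ← mulVec_transpose, hΛ]
  have hAs (v w : Fin d → ℝ) : v ⬝ᵥ A *ᵥ w = w ⬝ᵥ A *ᵥ v := by
    rw [dotProduct_mulVec, ← mulVec_transpose, hA, dotProduct_comm]
  have hKt (v w : Fin d → ℝ) : (Kᵀ *ᵥ v) ⬝ᵥ w = v ⬝ᵥ K *ᵥ w := by
    rw [dotProduct_mulVec, ← mulVec_transpose]
  have hcross : η ⬝ᵥ A *ᵥ (Λ *ᵥ u) = u ⬝ᵥ Λ *ᵥ (A *ᵥ η) := by
    rw [hAs, hΛs]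
  have hdrift : u ⬝ᵥ Kᵀ *ᵥ (Λ *ᵥ u) = u ⬝ᵥ Λ *ᵥ (K *ᵥ u) := by
    rw [dotProduct_comm, hKt, hΛs]
  rw [hL, hquad, haη, haΛ, hb]
  simp only [sub_mulVec, add_mulVec, mulVec_sub, ← mulVec_mulVec, sub_dotProduct, add_dotProduct,
    dotProduct_sub, dotProduct_add, hKt, hcross, hdrift, hΛs]
  rw [dotProduct_comm (A *ᵥ η), dotProduct_comm (K *ᵥ μ)]
  simp only [hΛs]
  ring
end
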